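/- Let g₀:ℝ^{2+1}→{symmetric invertible 3×3 real matrices} be smooth with det g₀<0. Let φₙ^{(1)}, φₙ^{(2)}, φₙ^{(3)} (n∈ℕ) be smooth real functions on ℝ^{2+1} such that for every compact K⊂ℝ^{2+1}: (1) max_{i=1,2,3} sup_n (‖∂φₙ^{(i)}‖_{L³(K)} + ‖□_{g₀}φₙ^{(i)}‖_{L³(K)}) < ∞, and (2) max_{i=1,2,3} ‖φₙ^{(i)}‖_{L³(K)} → 0 as n→∞. Then for every smooth vector field X = X^α∂_α on ℝ^{2+1} and every ϑ∈C_c^∞(ℝ^{2+1}), ∫_{ℝ^{2+1}} ϑ·(X^α∂_αφₙ^{(1)})·(g₀⁻¹)^{αβ}(∂_αφₙ^{(2)})(∂_βφₙ^{(3)}) dx → 0; that is, (Xφₙ^{(1)})·g₀⁻¹(dφₙ^{(2)},dφₙ^{(3)}) ⇀ 0 in the sense of distributions. -/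

import Mathlib

open MeasureTheory Real Filter
open scoped ENNReal

noncomputable section

abbrev E3 : Type := Fin 3 → ℝ

/-- Partial derivative in coordinate direction `α`. -/
noncomputable def pd (α : Fin 3) (f : E3 → ℝ) (x : E3) : ℝ :=
  fderiv ℝ f x (Pi.single α 1)

/-- Wave operator of a matrix-valued Lorentzian metric:
`□_g φ = (−det g)^{−1/2} ∂_α ((g⁻¹)^{αβ}(−det g)^{1/2} ∂_β φ)`. -/
noncomputable def boxM (g : E3 → Matrix (Fin 3) (Fin 3) ℝ) (φ : E3 → ℝ) (x : E3) : ℝ :=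
  (Real.sqrt (-(g x).det))⁻¹ *
    ∑ α, pd α (fun y => ∑ β', (g y)⁻¹ α β' * Real.sqrt (-(g y).det) * pd β' φ y) x

/-- Null form `g⁻¹(dφ, dψ) = (g⁻¹)^{αβ} ∂_α φ ∂_β ψ`. -/
noncomputable def nullFormM (g : E3 → Matrix (Fin 3) (Fin 3) ℝ) (φ ψ : E3 → ℝ) (x : E3) : ℝ :=
  ∑ α, ∑ β', (g x)⁻¹ α β' * pd α φ x * pd β' ψ x

lemma contDiff_pd (α : Fin 3) {f : E3 → ℝ} (hf : ContDiff ℝ (⊤ : ℕ∞) f) :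
    ContDiff ℝ (⊤ : ℕ∞) (pd α f) :=
  (hf.fderiv_right (m := (⊤ : ℕ∞)) (by simp)).clm_apply contDiff_const

lemma pd_add (α : Fin 3) {f g : E3 → ℝ} (hf : Differentiable ℝ f) (hg : Differentiable ℝ g)
    (x : E3) : pd α (fun y => f y + g y) x = pd α f x + pd α g x := by
  simp [pd, fderiv_fun_add (hf x) (hg x)]

lemma pd_mul (α : Fin 3) {f g : E3 → ℝ} (hf : Differentiable ℝ f) (hg : Differentiable ℝ g)
    (x : E3) : pd α (fun y => f y * g y) x = pd α f x * g x + f x * pd α g x := by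
  simp only [pd, fderiv_fun_mul (hf x) (hg x), add_apply,
    smul_apply, smul_eq_mul]
  ring

lemma pd_comm (α β : Fin 3) {f : E3 → ℝ} (hf : ContDiff ℝ (⊤ : ℕ∞) f) (x : E3) :
    pd α (pd β f) x = pd β (pd α f) x := by
  have hd : DifferentiableAt ℝ (fderiv ℝ f) x :=
    ((hf.fderiv_right (m := (⊤ : ℕ∞)) (by simp)).differentiable (by simp)) x
  have key : ∀ a b : Fin 3, pd a (pd b f) x
      = fderiv ℝ (fderiv ℝ f) x (Pi.single a 1) (Pi.single b 1) := by
    intro a b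
    change fderiv ℝ (fun y => fderiv ℝ f y (Pi.single b 1)) x (Pi.single a 1) = _
    rw [fderiv_clm_apply hd (differentiableAt_const _)]
    simp
  rw [key, key]
  exact (hf.contDiffAt.isSymmSndFDerivAt
    (by simpa using WithTop.coe_le_coe.2 (le_top : (2 : ℕ∞) ≤ ⊤))) _ _

lemma hasCompactSupport_pd (α : Fin 3) {f : E3 → ℝ} (hf : HasCompactSupport f) :
    HasCompactSupport (pd α f) :=
  hf.fderiv_apply (𝕜 := ℝ) _

lemma integral_pd_eq_zero (α : Fin 3) {f : E3 → ℝ} (hf : ContDiff ℝ (⊤ : ℕ∞) f)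
    (hc : HasCompactSupport f) : ∫ x, pd α f x = 0 := by
  have hi : Integrable (pd α f) :=
    (contDiff_pd α hf).continuous.integrable_of_hasCompactSupport (hasCompactSupport_pd α hc)
  have h := integral_mul_fderiv_eq_neg_fderiv_mul_of_integrable (μ := (volume : Measure E3))
    (f := fun _ : E3 => (1 : ℝ)) (g := f) (v := Pi.single α 1) (by simp)
    (by simp only [one_mul]; exact hi)
    (by simpa using hf.continuous.integrable_of_hasCompactSupport hc)
    (fun x _ => differentiableAt_const _) (fun x _ => (hf.differentiable (by simp)) x)
  simpa [pd] using h

/-- The divergence-form second-order operator `∂_α (a^{αβ} ∂_β φ)`. -/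
def divOp (a : Fin 3 → Fin 3 → E3 → ℝ) (φ : E3 → ℝ) (x : E3) : ℝ :=
  ∑ α, pd α (fun y => ∑ β, a α β y * pd β φ y) x

lemma contDiff_divOp {a : Fin 3 → Fin 3 → E3 → ℝ} (ha : ∀ α β, ContDiff ℝ (⊤ : ℕ∞) (a α β))
    {φ : E3 → ℝ} (hφ : ContDiff ℝ (⊤ : ℕ∞) φ) : ContDiff ℝ (⊤ : ℕ∞) (divOp a φ) :=
  ContDiff.sum fun α _ => contDiff_pd α <| ContDiff.sum fun β _ =>
    (ha α β).mul (contDiff_pd β hφ)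

lemma divOp_mul {a : Fin 3 → Fin 3 → E3 → ℝ} (ha : ∀ α β, ContDiff ℝ (⊤ : ℕ∞) (a α β))
    (hs : ∀ α β, a α β = a β α) {v w : E3 → ℝ} (hv : ContDiff ℝ (⊤ : ℕ∞) v)
    (hw : ContDiff ℝ (⊤ : ℕ∞) w) (x : E3) :
    divOp a (fun y => v y * w y) x = v x * divOp a w x + w x * divOp a v x
      + 2 * ∑ α, ∑ β, a α β x * pd α v x * pd β w x := by
  have hv' : Differentiable ℝ v := hv.differentiable (by simp)
  have hw' : Differentiable ℝ w := hw.differentiable (by simp)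
  have hdv : ∀ β, Differentiable ℝ (pd β v) := fun β => (contDiff_pd β hv).differentiable (by simp)
  have hdw : ∀ β, Differentiable ℝ (pd β w) := fun β => (contDiff_pd β hw).differentiable (by simp)
  have ha' : ∀ α β, Differentiable ℝ (a α β) := fun α β => (ha α β).differentiable (by simp)
  have hvw : ∀ β, pd β (fun y => v y * w y) = fun y => pd β v y * w y + v y * pd β w y :=
    fun β => funext fun y => pd_mul β hv' hw' y
  simp only [divOp, hvw, Fin.sum_univ_three]
  simp (disch := fun_prop) only [pd_add, pd_mul]
  rw [hs 1 0, hs 2 0, hs 2 1]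
  ring

/-- The zeroth-order coefficients of `∂u ∂ψ` left over after integrating by parts. -/
def remCoeff (a : Fin 3 → Fin 3 → E3 → ℝ) (Y : Fin 3 → E3 → ℝ) (γ β : Fin 3) (x : E3) : ℝ :=
  ∑ δ, (Y δ x * pd δ (a γ β) x + pd δ (Y δ) x * a γ β x
    - a δ β x * pd δ (Y γ) x - a δ γ x * pd δ (Y β) x)

/-- The vector field whose divergence absorbs the top-order terms. -/
def fluxField (a : Fin 3 → Fin 3 → E3 → ℝ) (Y : Fin 3 → E3 → ℝ) (u ψ : E3 → ℝ) (α : Fin 3)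
    (x : E3) : ℝ :=
  (∑ γ, Y γ x * pd γ u x) * (∑ β, a α β x * pd β ψ x)
    + (∑ γ, Y γ x * pd γ ψ x) * (∑ β, a α β x * pd β u x)
    + Y α x * (∑ β, (∑ γ, a β γ x * pd γ u x) * pd β ψ x) * (-1)

lemma mul_divOp_eq {a : Fin 3 → Fin 3 → E3 → ℝ} (ha : ∀ α β, ContDiff ℝ (⊤ : ℕ∞) (a α β))
    (hs : ∀ α β, a α β = a β α) {Y : Fin 3 → E3 → ℝ} (hY : ∀ α, ContDiff ℝ (⊤ : ℕ∞) (Y α))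
    {u ψ : E3 → ℝ} (hu : ContDiff ℝ (⊤ : ℕ∞) u) (hψ : ContDiff ℝ (⊤ : ℕ∞) ψ) (x : E3) :
    (∑ γ, Y γ x * pd γ u x) * divOp a ψ x = ∑ α, pd α (fluxField a Y u ψ α) x
      + ∑ γ, ∑ β, remCoeff a Y γ β x * pd γ u x * pd β ψ x
      - ∑ γ, Y γ x * divOp a u x * pd γ ψ x := by
  have hdu : ∀ β, Differentiable ℝ (pd β u) := fun β => (contDiff_pd β hu).differentiable (by simp)
  have hdψ : ∀ β, Differentiable ℝ (pd β ψ) := fun β => (contDiff_pd β hψ).differentiable (by simp)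
  have ha' : ∀ α β, Differentiable ℝ (a α β) := fun α β => (ha α β).differentiable (by simp)
  have hY' : ∀ α, Differentiable ℝ (Y α) := fun α => (hY α).differentiable (by simp)
  have hconst : ∀ α, pd α (fun _ : E3 => (-1 : ℝ)) x = 0 := fun α => by simp [pd]
  unfold fluxField
  simp only [divOp, remCoeff, Fin.sum_univ_three]
  simp (disch := fun_prop) only [pd_add, pd_mul, hconst]
  rw [hs 1 0, hs 2 0, hs 2 1, pd_comm 1 0 hu, pd_comm 2 0 hu, pd_comm 2 1 hu,
    pd_comm 1 0 hψ, pd_comm 2 0 hψ, pd_comm 2 1 hψ]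
  ring

lemma enorm_integral_mul_le {c p q r : E3 → ℝ}
    (hp : Continuous p) (hq : Continuous q) (hr : Continuous r) {M : ℝ} (hM : ∀ x, ‖c x‖ ≤ M) :
    ‖∫ x, c x * p x * q x * r x‖ₑ ≤ ENNReal.ofReal M *
      (eLpNorm p 3 (volume.restrict (tsupport c)) * (eLpNorm q 3 (volume.restrict (tsupport c)) *
        eLpNorm r 3 (volume.restrict (tsupport c)))) := by
  have h1 : ENNReal.HolderTriple 3 3 (3 / 2) := ⟨by
    rw [ENNReal.inv_div (by simp) (by simp), ENNReal.div_eq_inv_mul, mul_two]⟩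
  have h2 : ENNReal.HolderTriple 3 (3 / 2) 1 := ⟨by
    rw [ENNReal.inv_div (by simp) (by simp), inv_one, ← one_div, ENNReal.div_add_div_same]
    norm_num
    exact ENNReal.div_self (by simp) (by simp)⟩
  set μ := (volume : Measure E3).restrict (tsupport c)
  have hset : ∫ x, c x * p x * q x * r x = ∫ x, c x * p x * q x * r x ∂μ := by
    refine (setIntegral_eq_integral_of_forall_compl_eq_zero fun x hx => ?_).symm
    simp [image_eq_zero_of_notMem_tsupport hx]
  rw [hset]
  have hqr := eLpNorm_smul_le_mul_eLpNorm (p := 3) (q := 3) (r := 3 / 2) (μ := μ)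
    hr.aestronglyMeasurable hq.aestronglyMeasurable
  have hpqr := eLpNorm_smul_le_mul_eLpNorm (p := 3) (q := 3 / 2) (r := 1) (μ := μ)
    (hq.smul hr).aestronglyMeasurable hp.aestronglyMeasurable
  calc ‖∫ x, c x * p x * q x * r x ∂μ‖ₑ ≤ ∫⁻ x, ‖c x * p x * q x * r x‖ₑ ∂μ :=
        enorm_integral_le_lintegral_enorm _
    _ = eLpNorm (fun x => c x * p x * q x * r x) 1 μ := eLpNorm_one_eq_lintegral_enorm.symm
    _ ≤ ENNReal.ofReal M * eLpNorm (p • (q • r)) 1 μ := by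
        refine eLpNorm_le_mul_eLpNorm_of_ae_le_mul (Eventually.of_forall fun x => ?_) 1
        have : c x * p x * q x * r x = c x * (p • (q • r)) x := by
          simp [mul_assoc]
        rw [this, norm_mul]
        exact mul_le_mul_of_nonneg_right (hM x) (norm_nonneg _)
    _ ≤ _ := by
        gcongr
        exact hpqr.trans (by gcongr)

/-- A sequence of continuous functions bounded in `L³` on compact sets. -/
structure LocBdd (f : ℕ → E3 → ℝ) : Prop where
  cont : ∀ n, Continuous (f n)
  bdd : ∀ K : Set E3, IsCompact K → ∃ C : ℝ≥0∞, C ≠ ∞ ∧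
    ∀ n, eLpNorm (f n) 3 (volume.restrict K) ≤ C

/-- A sequence of continuous functions tending to zero in `L³` on compact sets. -/
structure LocNull (f : ℕ → E3 → ℝ) : Prop where
  cont : ∀ n, Continuous (f n)
  tendsto : ∀ K : Set E3, IsCompact K →
    Tendsto (fun n => eLpNorm (f n) 3 (volume.restrict K)) atTop (nhds 0)

/-- A sequence of integrable functions whose integrals tend to zero. -/
structure IntNull (f : ℕ → E3 → ℝ) : Prop where
  int : ∀ n, Integrable (f n)
  tendsto : Tendsto (fun n => ∫ x, f n x) atTop (nhds 0)

lemma IntNull.add {f g : ℕ → E3 → ℝ} (hf : IntNull f) (hg : IntNull g) :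
    IntNull fun n x => f n x + g n x where
  int n := (hf.int n).add (hg.int n)
  tendsto := by
    simp_rw [fun n => integral_add (hf.int n) (hg.int n)]
    simpa using hf.tendsto.add hg.tendsto

lemma IntNull.const_mul {f : ℕ → E3 → ℝ} (hf : IntNull f) (k : ℝ) :
    IntNull fun n x => k * f n x where
  int n := (hf.int n).const_mul k
  tendsto := by
    simp_rw [integral_const_mul]
    simpa using hf.tendsto.const_mul k

lemma IntNull.sum {ι : Type*} (s : Finset ι) {f : ι → ℕ → E3 → ℝ} (hf : ∀ i, IntNull (f i)) :
    IntNull fun n x => ∑ i ∈ s, f i n x where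
  int n := integrable_finsetSum s fun i _ => (hf i).int n
  tendsto := by
    simp_rw [fun n => integral_finsetSum s fun i _ => (hf i).int n]
    simpa using tendsto_finsetSum s fun i _ => (hf i).tendsto

lemma LocBdd.intNull_mul {c : E3 → ℝ} (hc : Continuous c) (hcc : HasCompactSupport c)
    {p q r : ℕ → E3 → ℝ} (hp : LocBdd p) (hq : LocBdd q) (hr : LocNull r) :
    IntNull fun n x => c x * p n x * q n x * r n x where
  int n := by
    refine Continuous.integrable_of_hasCompactSupport
      (((hc.mul (hp.cont n)).mul (hq.cont n)).mul (hr.cont n)) ?_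
    exact hcc.mul_right.mul_right.mul_right
  tendsto := by
    obtain ⟨M, hM⟩ := hc.bounded_above_of_compact_support hcc
    obtain ⟨A, hA, hpA⟩ := hp.bdd _ hcc
    obtain ⟨B, hB, hqB⟩ := hq.bdd _ hcc
    rw [tendsto_zero_iff_enorm_tendsto_zero]
    have hlim : Tendsto (fun n => ENNReal.ofReal M * (A * (B *
        eLpNorm (r n) 3 (volume.restrict (tsupport c))))) atTop (nhds 0) := by
      have h1 := ENNReal.Tendsto.const_mul (hr.tendsto _ hcc) (Or.inr hB)
      have h2 := ENNReal.Tendsto.const_mul h1 (Or.inr hA)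
      have h3 := ENNReal.Tendsto.const_mul h2 (Or.inr (ENNReal.ofReal_ne_top (r := M)))
      simpa using h3
    refine tendsto_of_tendsto_of_tendsto_of_le_of_le tendsto_const_nhds hlim
      (fun _ => zero_le) fun n => ?_
    refine (enorm_integral_mul_le (hp.cont n) (hq.cont n) (hr.cont n) hM).trans ?_
    have h1 := hpA n
    have h2 := hqB n
    gcongr

lemma LocBdd.continuous_mul {f : ℕ → E3 → ℝ} (hf : LocBdd f) {k : E3 → ℝ} (hk : Continuous k) :
    LocBdd fun n x => k x * f n x where
  cont n := hk.mul (hf.cont n)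
  bdd K hK := by
    obtain ⟨C, hC, hfC⟩ := hf.bdd K hK
    obtain ⟨M, hM⟩ := hK.exists_bound_of_continuousOn hk.continuousOn
    refine ⟨ENNReal.ofReal M * C, ENNReal.mul_ne_top ENNReal.ofReal_ne_top hC, fun n => ?_⟩
    refine (eLpNorm_le_mul_eLpNorm_of_ae_le_mul (g := f n) (c := M) ?_ 3).trans ?_
    · refine (ae_restrict_iff' hK.measurableSet).2 (Eventually.of_forall fun x hx => ?_)
      rw [norm_mul]
      exact mul_le_mul_of_nonneg_right (hM x hx) (norm_nonneg _)
    · have := hfC n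
      gcongr

lemma contDiff_det {g : E3 → Matrix (Fin 3) (Fin 3) ℝ}
    (hg : ∀ α β, ContDiff ℝ (⊤ : ℕ∞) (fun x => g x α β)) :
    ContDiff ℝ (⊤ : ℕ∞) (fun x => (g x).det) := by
  simp only [Matrix.det_apply']
  exact ContDiff.sum fun σ _ => contDiff_const.mul (contDiff_prod fun i _ => hg _ _)

lemma contDiff_inv_apply {g : E3 → Matrix (Fin 3) (Fin 3) ℝ}
    (hg : ∀ α β, ContDiff ℝ (⊤ : ℕ∞) (fun x => g x α β)) (hdet : ∀ x, (g x).det ≠ 0)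
    (α β : Fin 3) : ContDiff ℝ (⊤ : ℕ∞) (fun x => (g x)⁻¹ α β) := by
  have h : (fun x => (g x)⁻¹ α β) = fun x => ((g x).det)⁻¹ * (g x).adjugate α β := by
    ext x
    simp [Matrix.inv_def]
  rw [h]
  refine ((contDiff_det hg).inv hdet).mul ?_
  simp only [Matrix.adjugate_apply]
  refine contDiff_det fun i j => ?_
  by_cases hi : i = β
  · subst hi
    simpa using contDiff_const
  · simpa [Matrix.updateRow_ne hi] using hg i j

/-- Trilinear compensated compactness for a divergence-form operator with symmetric smooth
coefficients. -/
lemma intNull_trilinear {a : Fin 3 → Fin 3 → E3 → ℝ} (ha : ∀ α β, ContDiff ℝ (⊤ : ℕ∞) (a α β))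
    (hs : ∀ α β, a α β = a β α) {Y : Fin 3 → E3 → ℝ} (hY : ∀ α, ContDiff ℝ (⊤ : ℕ∞) (Y α))
    (hYc : ∀ α, HasCompactSupport (Y α)) {φ : Fin 3 → ℕ → E3 → ℝ}
    (hφ : ∀ i n, ContDiff ℝ (⊤ : ℕ∞) (φ i n))
    (hd : ∀ i α, LocBdd fun n => pd α (φ i n)) (hb : ∀ i, LocBdd fun n => divOp a (φ i n))
    (hz : ∀ i, LocNull (φ i)) :
    IntNull fun n x => (∑ γ, Y γ x * pd γ (φ 0 n) x)
      * ∑ α, ∑ β, a α β x * pd α (φ 1 n) x * pd β (φ 2 n) x := by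
  have hrc : ∀ γ β, Continuous (remCoeff a Y γ β) := fun γ β =>
    continuous_finsetSum _ fun δ _ => by
      have := (contDiff_pd δ (ha γ β)).continuous
      have := (contDiff_pd δ (hY δ)).continuous
      have := (contDiff_pd δ (hY γ)).continuous
      have := (contDiff_pd δ (hY β)).continuous
      have := fun α β => (ha α β).continuous
      have := fun α => (hY α).continuous
      fun_prop
  have hrs : ∀ γ β, HasCompactSupport (remCoeff a Y γ β) := by
    intro γ β
    have hU : IsCompact (⋃ δ, tsupport (Y δ)) := isCompact_iUnion fun δ => hYc δ
    refine HasCompactSupport.intro hU fun x hx => ?_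
    have hx' : ∀ δ, x ∉ tsupport (Y δ) := by simpa using hx
    have h0 : ∀ δ, Y δ x = 0 := fun δ => image_eq_zero_of_notMem_tsupport (hx' δ)
    have h1 : ∀ δ ε, pd ε (Y δ) x = 0 := fun δ ε => by
      simp [pd, fderiv_of_notMem_tsupport (𝕜 := ℝ) (hx' δ)]
    simp [remCoeff, h0, h1]
  have hflux : ∀ n α, ContDiff ℝ (⊤ : ℕ∞)
      (fluxField a Y (φ 0 n) (fun y => φ 1 n y * φ 2 n y) α) := by
    intro n α
    have hdu := fun β => contDiff_pd β (hφ 0 n)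
    have hdψ := fun β => contDiff_pd β ((hφ 1 n).mul (hφ 2 n))
    unfold fluxField
    fun_prop
  have hfluxc : ∀ n α, HasCompactSupport
      (fluxField a Y (φ 0 n) (fun y => φ 1 n y * φ 2 n y) α) := by
    intro n α
    have hU : IsCompact (⋃ δ, tsupport (Y δ)) := isCompact_iUnion fun δ => hYc δ
    refine HasCompactSupport.intro hU fun x hx => ?_
    have hx' : ∀ δ, x ∉ tsupport (Y δ) := by simpa using hx
    have h0 : ∀ δ, Y δ x = 0 := fun δ => image_eq_zero_of_notMem_tsupport (hx' δ)
    simp [fluxField, h0]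
  have hdiv : IntNull fun n x => ∑ α, pd α
      (fluxField a Y (φ 0 n) (fun y => φ 1 n y * φ 2 n y) α) x := by
    refine IntNull.sum _ fun α => ⟨fun n => ?_, ?_⟩
    · exact (contDiff_pd α (hflux n α)).continuous.integrable_of_hasCompactSupport
        (hasCompactSupport_pd α (hfluxc n α))
    · simp_rw [fun n => integral_pd_eq_zero α (hflux n α) (hfluxc n α)]
      exact tendsto_const_nhds
  have hYcont := fun α => (hY α).continuous
  have hrem1 := IntNull.sum Finset.univ fun γ => IntNull.sum Finset.univ fun β =>
    (LocBdd.intNull_mul (hrc γ β) (hrs γ β) (hd 0 γ) (hd 1 β) (hz 2)).add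
      (LocBdd.intNull_mul (hrc γ β) (hrs γ β) (hd 0 γ) (hd 2 β) (hz 1))
  have hrem2 := IntNull.sum Finset.univ fun γ =>
    (LocBdd.intNull_mul (hYcont γ) (hYc γ) (hb 0) (hd 1 γ) (hz 2)).add
      (LocBdd.intNull_mul (hYcont γ) (hYc γ) (hb 0) (hd 2 γ) (hz 1))
  have hrem3 := IntNull.sum Finset.univ fun γ =>
    (LocBdd.intNull_mul (hYcont γ) (hYc γ) (hd 0 γ) (hb 2) (hz 1)).add
      (LocBdd.intNull_mul (hYcont γ) (hYc γ) (hd 0 γ) (hb 1) (hz 2))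
  have hall := ((hdiv.add hrem1).add ((hrem2.add hrem3).const_mul (-1))).const_mul (1 / 2)
  convert hall using 3 with n x
  have e1 := divOp_mul ha hs (hφ 1 n) (hφ 2 n) x
  have e2 := mul_divOp_eq ha hs hY (hφ 0 n) ((hφ 1 n).mul (hφ 2 n)) x
  have hψ : ∀ β, pd β (fun y => φ 1 n y * φ 2 n y) x
      = pd β (φ 1 n) x * φ 2 n x + φ 1 n x * pd β (φ 2 n) x := fun β =>
    pd_mul β ((hφ 1 n).differentiable (by simp)) ((hφ 2 n).differentiable (by simp)) x
  rw [e1] at e2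
  simp only [hψ] at e2
  have r1 : ∑ γ, ∑ β, remCoeff a Y γ β x * pd γ (φ 0 n) x
        * (pd β (φ 1 n) x * φ 2 n x + φ 1 n x * pd β (φ 2 n) x)
      = ∑ γ, ∑ β, (remCoeff a Y γ β x * pd γ (φ 0 n) x * pd β (φ 1 n) x * φ 2 n x
        + remCoeff a Y γ β x * pd γ (φ 0 n) x * pd β (φ 2 n) x * φ 1 n x) :=
    Finset.sum_congr rfl fun γ _ => Finset.sum_congr rfl fun β _ => by ring
  have r2 : ∑ γ, Y γ x * divOp a (φ 0 n) x
        * (pd γ (φ 1 n) x * φ 2 n x + φ 1 n x * pd γ (φ 2 n) x)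
      = ∑ γ, (Y γ x * divOp a (φ 0 n) x * pd γ (φ 1 n) x * φ 2 n x
        + Y γ x * divOp a (φ 0 n) x * pd γ (φ 2 n) x * φ 1 n x) :=
    Finset.sum_congr rfl fun γ _ => by ring
  have r3 : (∑ γ, Y γ x * pd γ (φ 0 n) x)
        * (φ 1 n x * divOp a (φ 2 n) x + φ 2 n x * divOp a (φ 1 n) x)
      = ∑ γ, (Y γ x * pd γ (φ 0 n) x * divOp a (φ 2 n) x * φ 1 n x
        + Y γ x * pd γ (φ 0 n) x * divOp a (φ 1 n) x * φ 2 n x) := by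
    rw [Finset.sum_mul]
    exact Finset.sum_congr rfl fun γ _ => by ring
  rw [r1, r2, mul_add, r3] at e2
  linarith

/-- Proposition `prop:trilinear.wave.0` of Huneau–Luk, trilinear compensated
compactness for three waves: if all three sequences have gradients and `□_{g₀}`-images bounded
in `L³_loc` and the functions themselves tend to `0` in `L³_loc`, then
`(Xφₙ^{(1)}) · g₀⁻¹(dφₙ^{(2)}, dφₙ^{(3)}) ⇀ 0` in the sense of distributions. -/
theorem stmt10
    (g₀ : E3 → Matrix (Fin 3) (Fin 3) ℝ)
    (hg₀ : ∀ α β', ContDiff ℝ (⊤ : ℕ∞) (fun x => g₀ x α β'))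
    (hgsymm : ∀ x, (g₀ x).IsSymm)
    (hgdet : ∀ x, (g₀ x).det < 0)
    (φ : Fin 3 → ℕ → E3 → ℝ)
    (hφreg : ∀ i n, ContDiff ℝ (⊤ : ℕ∞) (φ i n))
    -- (1) uniform L³ bounds on gradients and wave operators
    (hbdd : ∀ K : Set E3, IsCompact K → ∃ C : ℝ, ∀ i n, ∀ α : Fin 3,
      eLpNorm (pd α (φ i n)) 3 (volume.restrict K) ≤ ENNReal.ofReal C ∧
      eLpNorm (boxM g₀ (φ i n)) 3 (volume.restrict K) ≤ ENNReal.ofReal C)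
    -- (2) L³ convergence to 0
    (hconv : ∀ K : Set E3, IsCompact K → ∀ i,
      Tendsto (fun n => eLpNorm (φ i n) 3 (volume.restrict K)) atTop (nhds 0)) :
    ∀ X : Fin 3 → E3 → ℝ, (∀ α, ContDiff ℝ (⊤ : ℕ∞) (X α)) →
      ∀ ϑ : E3 → ℝ, ContDiff ℝ (⊤ : ℕ∞) ϑ → HasCompactSupport ϑ →
        Tendsto (fun n => ∫ x, ϑ x * (∑ α, X α x * pd α (φ 0 n) x)
          * nullFormM g₀ (φ 1 n) (φ 2 n) x) atTop (nhds 0) := by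
  intro X hX ϑ hϑ hϑc
  have hdet0 : ∀ x, (g₀ x).det ≠ 0 := fun x => (hgdet x).ne
  have hpos : ∀ x, 0 < -(g₀ x).det := fun x => neg_pos.2 (hgdet x)
  have hWpos : ∀ x, Real.sqrt (-(g₀ x).det) ≠ 0 := fun x => (Real.sqrt_pos.2 (hpos x)).ne'
  have hW : ContDiff ℝ (⊤ : ℕ∞) (fun x => Real.sqrt (-(g₀ x).det)) :=
    (contDiff_det hg₀).neg.sqrt fun x => (hpos x).ne'
  set a : Fin 3 → Fin 3 → E3 → ℝ := fun α β y => (g₀ y)⁻¹ α β * Real.sqrt (-(g₀ y).det) with ha_def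
  have ha : ∀ α β, ContDiff ℝ (⊤ : ℕ∞) (a α β) := fun α β =>
    (contDiff_inv_apply hg₀ hdet0 α β).mul hW
  have hs : ∀ α β, a α β = a β α := by
    intro α β
    ext y
    have : ((g₀ y)⁻¹).transpose = (g₀ y)⁻¹ := by
      rw [Matrix.transpose_nonsing_inv, (hgsymm y).eq]
    simp only [ha_def]
    rw [← this, Matrix.transpose_apply, this]
  have hbox : ∀ i n, divOp a (φ i n) = fun x => Real.sqrt (-(g₀ x).det) * boxM g₀ (φ i n) x := by
    intro i n
    ext x
    rw [boxM, mul_inv_cancel_left₀ (hWpos x)]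
    rfl
  have hboxc : ∀ i n, Continuous (boxM g₀ (φ i n)) := fun i n =>
    (hW.continuous.inv₀ hWpos).mul (contDiff_divOp ha (hφreg i n)).continuous
  have hd : ∀ i α, LocBdd fun n => pd α (φ i n) := fun i α =>
    ⟨fun n => (contDiff_pd α (hφreg i n)).continuous, fun K hK =>
      let ⟨C, hC⟩ := hbdd K hK
      ⟨ENNReal.ofReal C, ENNReal.ofReal_ne_top, fun n => (hC i n α).1⟩⟩
  have hb : ∀ i, LocBdd fun n => divOp a (φ i n) := by
    intro i
    simp only [hbox]
    refine LocBdd.continuous_mul ⟨fun n => hboxc i n, fun K hK => ?_⟩ hW.continuous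
    obtain ⟨C, hC⟩ := hbdd K hK
    exact ⟨ENNReal.ofReal C, ENNReal.ofReal_ne_top, fun n => (hC i n 0).2⟩
  have hz : ∀ i, LocNull (φ i) := fun i =>
    ⟨fun n => (hφreg i n).continuous, fun K hK => hconv K hK i⟩
  have key := (intNull_trilinear ha hs
    (Y := fun γ x => ϑ x * (X γ x * (Real.sqrt (-(g₀ x).det))⁻¹))
    (fun γ => hϑ.mul ((hX γ).mul (hW.inv hWpos))) (fun γ => hϑc.mul_right) hφreg hd hb hz).tendsto
  convert key using 4 with n x
  have e1 : ∑ γ, ϑ x * (X γ x * (Real.sqrt (-(g₀ x).det))⁻¹) * pd γ (φ 0 n) x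
      = ϑ x * (∑ γ, X γ x * pd γ (φ 0 n) x) * (Real.sqrt (-(g₀ x).det))⁻¹ := by
    rw [Finset.mul_sum, Finset.sum_mul]
    exact Finset.sum_congr rfl fun γ _ => by ring
  have e2 : ∑ α, ∑ β, a α β x * pd α (φ 1 n) x * pd β (φ 2 n) x
      = Real.sqrt (-(g₀ x).det) * nullFormM g₀ (φ 1 n) (φ 2 n) x := by
    simp only [nullFormM, Finset.mul_sum, ha_def]
    exact Finset.sum_congr rfl fun α _ => Finset.sum_congr rfl fun β _ => by ring
  rw [e1, e2, mul_assoc _ (Real.sqrt (-(g₀ x).det))⁻¹, inv_mul_cancel_left₀ (hWpos x)]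

end
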